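/- arXiv:2605.25123 — 4 statements merged into one kernel-verified Lean document; each statement's English description precedes it below -/
import Mathlib

section
/- Let P and π be probability measures on a measurable space Ω with π ≪ P and P ≪ π, and let R = dπ/dP. Define the escort measure q_τ by dq_τ/dP = R^τ / ∫ R^τ dP. Suppose that for every τ ∈ [0,1], ∫ R^τ |log R|² dP < ∞. Then the function τ ↦ D_KL(q_τ‖P) is differentiable on (0,1) with derivative τ · Var_{q_τ}(log R) ≥ 0, and hence τ ↦ D_KL(q_τ‖P) is nondecreasing on [0,1]. -/
open MeasureTheory

/-- Kullback–Leibler divergence (real-valued): `D_KL(q‖p) = ∫ log (dq/dp) dq`. -/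
noncomputable def klDiv {Ω : Type*} [MeasurableSpace Ω] (q p : Measure Ω) : ℝ :=
  ∫ x, llr q p x ∂q

namespace ProbabilityTheory

open Set

variable {Ω : Type*} {m : MeasurableSpace Ω} {μ : Measure Ω} {X : Ω → ℝ} {t a b : ℝ}

lemma integral_tilted_mul_eq_div_mgf (g : Ω → ℝ) (t : ℝ) :
    ∫ x, g x ∂(μ.tilted (fun x => t * X x)) =
      (∫ x, g x * Real.exp (t * X x) ∂μ) / mgf X μ t := by
  rw [integral_tilted_mul_eq_mgf, ← integral_div]
  congr with x
  rw [smul_eq_mul]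
  ring

lemma integral_llr_tilted_mul_self [IsProbabilityMeasure μ]
    (ht : Integrable (fun x => Real.exp (t * X x)) μ)
    (hXt : Integrable (fun x => X x * Real.exp (t * X x)) μ) :
    ∫ x, llr (μ.tilted (fun x => t * X x)) μ x ∂(μ.tilted (fun x => t * X x)) =
      t * ((∫ x, X x * Real.exp (t * X x) ∂μ) / mgf X μ t) - cgf X μ t := by
  have := isProbabilityMeasure_tilted ht
  have hX : Integrable X (μ.tilted (fun x => t * X x)) := by
    rw [integrable_tilted_iff ht]
    simpa only [smul_eq_mul, mul_comm] using hXt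
  have hllr : llr (μ.tilted (fun x => t * X x)) μ
      =ᵐ[μ.tilted (fun x => t * X x)] fun x => t * X x - cgf X μ t :=
    (tilted_absolutelyContinuous μ _).ae_le (log_rnDeriv_tilted_left_self ht)
  rw [integral_congr_ae hllr, integral_sub (hX.const_mul t) (integrable_const _),
    integral_const_mul, integral_tilted_mul_eq_div_mgf]
  simp

lemma hasDerivAt_mul_deriv_cgf_sub_cgf (ht : t ∈ interior (integrableExpSet X μ)) :
    HasDerivAt (fun s => s * deriv (cgf X μ) s - cgf X μ s)
      (t * iteratedDeriv 2 (cgf X μ) t) t := by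
  have h₁ := (analyticAt_cgf ht).differentiableAt.hasDerivAt
  have h₂ := (analyticAt_cgf ht).deriv.differentiableAt.hasDerivAt
  have h := ((hasDerivAt_id t).mul h₂).sub h₁
  rw [iteratedDeriv_succ, iteratedDeriv_one]
  refine h.congr_deriv ?_
  simp

lemma continuousOn_integral_mul_exp {g : Ω → ℝ} (hX : AEMeasurable X μ)
    (ha : Integrable (fun x => g x * Real.exp (a * X x)) μ)
    (hb : Integrable (fun x => g x * Real.exp (b * X x)) μ) (hg : AEMeasurable g μ) :
    ContinuousOn (fun t => ∫ x, g x * Real.exp (t * X x) ∂μ) (Icc a b) := by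
  refine continuousOn_of_dominated
    (bound := fun x => ‖g x * Real.exp (a * X x)‖ + ‖g x * Real.exp (b * X x)‖)
    (fun t _ => (hg.mul (hX.const_mul t).exp).aestronglyMeasurable) ?_ (ha.norm.add hb.norm) ?_
  · refine fun t ht => .of_forall fun x => ?_
    simp only [norm_mul, Real.norm_eq_abs, Real.abs_exp, ← mul_add]
    gcongr
    rcases le_total 0 (X x) with hx | hx
    · exact (Real.exp_le_exp.2 (mul_le_mul_of_nonneg_right ht.2 hx)).trans
        (le_add_of_nonneg_left (Real.exp_pos _).le)
    · exact (Real.exp_le_exp.2 (mul_le_mul_of_nonpos_right ht.1 hx)).trans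
        (le_add_of_nonneg_right (Real.exp_pos _).le)
  · exact .of_forall fun x => by fun_prop

/-- The hypotheses say that `exp (t * X)` and `X * exp (t * X)` are integrable at both endpoints,
which suffices for the relative entropy of the tilted measures to be continuous up to them. -/
lemma continuousOn_mul_div_mgf_sub_cgf [NeZero μ] (hX : AEMeasurable X μ)
    (ha : a ∈ integrableExpSet X μ) (hb : b ∈ integrableExpSet X μ)
    (hXa : Integrable (fun x => X x * Real.exp (a * X x)) μ)
    (hXb : Integrable (fun x => X x * Real.exp (b * X x)) μ) :
    ContinuousOn
      (fun t => t * ((∫ x, X x * Real.exp (t * X x) ∂μ) / mgf X μ t) - cgf X μ t) (Icc a b) := by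
  have hmgf : ContinuousOn (mgf X μ) (Icc a b) := by
    refine (continuousOn_integral_mul_exp (g := fun _ => 1) hX ?_ ?_ aemeasurable_const).congr ?_
    · simpa [integrableExpSet] using ha
    · simpa [integrableExpSet] using hb
    · intro t _
      simp [mgf]
  have hpos : ∀ t ∈ Icc a b, mgf X μ t ≠ 0 := fun t ht =>
    (mgf_pos' (NeZero.ne μ) (convex_integrableExpSet.ordConnected.out ha hb ht)).ne'
  exact (continuousOn_id.mul ((continuousOn_integral_mul_exp hX hXa hXb hX).div hmgf hpos)).sub
    (hmgf.log hpos)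

lemma variance_tilted_mul_eq_sub [IsProbabilityMeasure μ]
    (ht : t ∈ interior (integrableExpSet X μ)) :
    Var[X; μ.tilted (fun x => t * X x)] = (∫ x, X x ^ 2 ∂(μ.tilted (fun x => t * X x))) -
      (∫ x, X x ∂(μ.tilted (fun x => t * X x))) ^ 2 := by
  have := isProbabilityMeasure_tilted (interior_subset (s := integrableExpSet X μ) ht)
  exact variance_eq_sub (memLp_tilted_mul ht 2)

end ProbabilityTheory

open ProbabilityTheory

/-- Along the escort path, `τ ↦ D_KL(q_τ‖P)` is differentiable on `(0,1)` with
derivative `τ · Var_{q_τ}(log R) ≥ 0`, hence nondecreasing on `[0,1]`. -/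
theorem escort_kl_to_proposal_monotone
    {Ω : Type*} [MeasurableSpace Ω] (P pi : Measure Ω)
    [IsProbabilityMeasure P] [IsProbabilityMeasure pi]
    (hπP : pi ≪ P) (hPπ : P ≪ pi)
    (R : Ω → ℝ) (hR : R = fun x => (pi.rnDeriv P x).toReal)
    (hmom : ∀ τ ∈ Set.Icc (0 : ℝ) 1,
      Integrable (fun x => R x ^ τ * |Real.log (R x)| ^ 2) P)
    (q : ℝ → Measure Ω)
    (hq : ∀ τ, q τ = P.withDensity (fun x =>
      ENNReal.ofReal (R x ^ τ / ∫ y, R y ^ τ ∂P))) :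
    (∀ τ ∈ Set.Ioo (0 : ℝ) 1,
      HasDerivAt (fun s => klDiv (q s) P)
        (τ * ((∫ x, Real.log (R x) ^ 2 ∂(q τ)) - (∫ x, Real.log (R x) ∂(q τ)) ^ 2)) τ ∧
      0 ≤ τ * ((∫ x, Real.log (R x) ^ 2 ∂(q τ)) - (∫ x, Real.log (R x) ∂(q τ)) ^ 2)) ∧
    MonotoneOn (fun s => klDiv (q s) P) (Set.Icc (0 : ℝ) 1) := by
  set X : Ω → ℝ := fun x => Real.log (R x)
  have hRpos : ∀ᵐ x ∂P, 0 < R x := by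
    filter_upwards [hPπ.ae_le (Measure.rnDeriv_pos hπP), pi.rnDeriv_ne_top P] with x h0 htop
    rw [hR]
    exact ENNReal.toReal_pos h0.ne' htop
  have hRmeas : Measurable R := hR ▸ (Measure.measurable_rnDeriv pi P).ennreal_toReal
  have hX : Measurable X := hRmeas.log
  have hpow : ∀ t : ℝ, (fun x => R x ^ t) =ᵐ[P] fun x => Real.exp (t * X x) := fun t => by
    filter_upwards [hRpos] with x hx
    rw [Real.rpow_def_of_pos hx, mul_comm]
  have hq_tilted : ∀ t, q t = P.tilted (fun x => t * X x) := fun t => by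
    rw [hq, Measure.tilted, integral_congr_ae (hpow t)]
    refine withDensity_congr_ae ?_
    filter_upwards [hpow t] with x hx
    rw [hx]
  have h0 : (0 : ℝ) ∈ integrableExpSet X P := by simp [integrableExpSet]
  have h1 : (1 : ℝ) ∈ integrableExpSet X P := by
    refine Integrable.congr ?_ (hpow 1)
    simpa [hR] using Measure.integrable_toReal_rnDeriv (μ := pi) (ν := P)
  have hmem : ∀ t ∈ Set.Icc (0 : ℝ) 1, t ∈ integrableExpSet X P := fun t ht =>
    convex_integrableExpSet.ordConnected.out h0 h1 ht
  have hint : ∀ t ∈ Set.Ioo (0 : ℝ) 1, t ∈ interior (integrableExpSet X P) := fun t ht =>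
    mem_interior.2 ⟨_, fun s hs => hmem s (Set.Ioo_subset_Icc_self hs), isOpen_Ioo, ht⟩
  have hXexp : ∀ t ∈ Set.Icc (0 : ℝ) 1, Integrable (fun x => X x * Real.exp (t * X x)) P := by
    intro t ht
    refine (Integrable.add (hmem t ht) (hmom t ht)).mono' (by fun_prop) ?_
    filter_upwards [hpow t] with x hx
    simp only [Pi.add_apply, hx, norm_mul, Real.norm_eq_abs, Real.abs_exp]
    have : |X x| ≤ 1 + |X x| ^ 2 := by nlinarith [sq_nonneg (|X x| - 1), abs_nonneg (X x)]
    nlinarith [Real.exp_pos (t * X x)]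
  have hkl : ∀ t ∈ Set.Icc (0 : ℝ) 1, klDiv (q t) P =
      t * ((∫ x, X x * Real.exp (t * X x) ∂P) / mgf X P t) - cgf X P t := fun t ht => by
    rw [klDiv, hq_tilted]
    exact integral_llr_tilted_mul_self (hmem t ht) (hXexp t ht)
  have hderiv : ∀ t ∈ Set.Ioo (0 : ℝ) 1, HasDerivAt (fun s => klDiv (q s) P)
      (t * ((∫ x, X x ^ 2 ∂(q t)) - (∫ x, X x ∂(q t)) ^ 2)) t ∧
      0 ≤ t * ((∫ x, X x ^ 2 ∂(q t)) - (∫ x, X x ∂(q t)) ^ 2) := fun t ht => by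
    rw [hq_tilted t, ← variance_tilted_mul_eq_sub (hint t ht)]
    refine ⟨?_, mul_nonneg ht.1.le (variance_nonneg _ _)⟩
    rw [variance_tilted_mul (hint t ht)]
    refine (hasDerivAt_mul_deriv_cgf_sub_cgf (hint t ht)).congr_of_eventuallyEq ?_
    filter_upwards [isOpen_Ioo.mem_nhds ht] with s hs
    rw [hkl s (Set.Ioo_subset_Icc_self hs), deriv_cgf (hint s hs)]
  refine ⟨hderiv, monotoneOn_of_deriv_nonneg (convex_Icc 0 1) ?_ ?_ ?_⟩
  · exact (continuousOn_mul_div_mgf_sub_cgf hX.aemeasurable h0 h1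
      (hXexp 0 (by simp)) (hXexp 1 (by simp))).congr hkl
  · rw [interior_Icc]
    exact fun t ht => (hderiv t ht).1.differentiableAt.differentiableWithinAt
  · rw [interior_Icc]
    intro t ht
    rw [(hderiv t ht).1.deriv]
    exact (hderiv t ht).2
end

section
/- Let P and π be probability measures on a measurable space Ω with π ≪ P and P ≪ π, let R = dπ/dP, and define the escort measure q_τ by dq_τ/dP = R^τ / ∫ R^τ dP. Suppose that for every τ ∈ [0,1], ∫ R^τ |log R|² dP < ∞, and suppose P ≠ π. Then R is not P-almost-surely constant, and for every τ ∈ (0,1) the variance Var_{q_τ}(log R) is strictly positive; consequently τ ↦ D_KL(q_τ‖P) is strictly increasing on (0,1] and τ ↦ D_KL(q_τ‖π) is strictly decreasing on [0,1). -/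
open MeasureTheory

open ProbabilityTheory

/-- The strict form of Jensen's inequality for the exponential, normalised by `∫ exp u = 1`. -/
lemma integral_neg_of_integral_exp_eq_one {Ω : Type*} [MeasurableSpace Ω] {μ : Measure Ω}
    [IsProbabilityMeasure μ] {u : Ω → ℝ} (hu : Integrable u μ)
    (hexp : ∫ x, Real.exp (u x) ∂μ = 1) (hne : ¬ u =ᵐ[μ] 0) :
    ∫ x, u x ∂μ < 0 := by
  have h_int : Integrable (fun x => Real.exp (u x)) μ := by
    by_contra h
    simp [integral_undef h] at hexp
  have hexp_sub_int : Integrable (fun x => Real.exp (u x) - 1) μ := h_int.sub (integrable_const 1)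
  have hnn : 0 ≤ fun x => Real.exp (u x) - 1 - u x := fun x => by
    have := Real.add_one_le_exp (u x)
    simp only [Pi.zero_apply]
    linarith
  have hval : ∫ x, (Real.exp (u x) - 1 - u x) ∂μ = -∫ x, u x ∂μ := by
    rw [integral_sub hexp_sub_int hu, integral_sub h_int (integrable_const 1), hexp]
    simp
  have hpos : 0 ≤ ∫ x, (Real.exp (u x) - 1 - u x) ∂μ := integral_nonneg hnn
  refine lt_of_le_of_ne (by linarith) fun h0 => hne ?_
  have hzero := (integral_eq_zero_iff_of_nonneg hnn (hexp_sub_int.sub hu)).1 (by rw [hval, h0, neg_zero])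
  filter_upwards [hzero] with x hx
  by_contra hux
  have := Real.add_one_lt_exp hux
  simp only [Pi.zero_apply] at hx
  linarith

/-- The mean under an exponential tilt is a strict subgradient of the cumulant generating
function when the variable is not almost surely constant. -/
lemma sub_mul_integral_tilted_lt_cgf_sub {Ω : Type*} [MeasurableSpace Ω] {μ : Measure Ω}
    [IsProbabilityMeasure μ] {X : Ω → ℝ} {s t : ℝ} (hst : s ≠ t)
    (hs : Integrable (fun x => Real.exp (s * X x)) μ)
    (ht : Integrable (fun x => Real.exp (t * X x)) μ)
    (hX : Integrable X (μ.tilted fun x => s * X x))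
    (hne : ¬ ∃ c : ℝ, X =ᵐ[μ] fun _ => c) :
    (t - s) * ∫ x, X x ∂(μ.tilted fun x => s * X x) < cgf X μ t - cgf X μ s := by
  have hprob : IsProbabilityMeasure (μ.tilted fun x => s * X x) := isProbabilityMeasure_tilted hs
  have key := integral_neg_of_integral_exp_eq_one
    (μ := μ.tilted fun x => s * X x)
    (u := fun x => (t - s) * X x - (cgf X μ t - cgf X μ s))
    ((hX.const_mul _).sub (integrable_const _)) ?_ ?_
  · rw [integral_sub (hX.const_mul _) (integrable_const _), integral_const_mul] at key
    simpa using key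
  · simp_rw [Real.exp_sub (_ * _), integral_div, integral_exp_tilted]
    have hsum : ∀ x, ((fun x => s * X x) + fun x => (t - s) * X x) x = t * X x := fun x => by
      simp only [Pi.add_apply]
      ring
    simp_rw [hsum]
    rw [Real.exp_sub, exp_cgf ht, exp_cgf hs]
    exact div_self (div_pos (integral_exp_pos ht) (integral_exp_pos hs)).ne'
  · intro h0
    refine hne ⟨(cgf X μ t - cgf X μ s) / (t - s), ?_⟩
    filter_upwards [(absolutelyContinuous_tilted hs).ae_le h0] with x hx
    rw [eq_div_iff (sub_ne_zero.2 hst.symm)]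
    simp only [Pi.zero_apply] at hx
    linarith

lemma variance_pos_of_not_ae_const {Ω : Type*} [MeasurableSpace Ω] {μ : Measure Ω}
    [IsFiniteMeasure μ] {X : Ω → ℝ} (hX : MemLp X 2 μ) (hne : ¬ ∃ c : ℝ, X =ᵐ[μ] fun _ => c) :
    0 < Var[X; μ] :=
  lt_of_le_of_ne (variance_nonneg _ _) fun h =>
    hne ⟨_, ae_eq_integral_of_variance_eq_zero hX h.symm⟩

lemma klDiv_tilted_mul_self {Ω : Type*} [MeasurableSpace Ω] {μ : Measure Ω}
    [IsProbabilityMeasure μ] {X : Ω → ℝ} {s : ℝ}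
    (hs : Integrable (fun x => Real.exp (s * X x)) μ)
    (hX : Integrable X (μ.tilted fun x => s * X x)) :
    klDiv (μ.tilted fun x => s * X x) μ
      = s * ∫ x, X x ∂(μ.tilted fun x => s * X x) - cgf X μ s := by
  have hprob : IsProbabilityMeasure (μ.tilted fun x => s * X x) := isProbabilityMeasure_tilted hs
  have h : llr (μ.tilted fun x => s * X x) μ =ᵐ[μ.tilted fun x => s * X x]
      fun x => s * X x - cgf X μ s :=
    (tilted_absolutelyContinuous μ _).ae_le (log_rnDeriv_tilted_left_self hs)
  rw [klDiv, integral_congr_ae h, integral_sub (hX.const_mul _) (integrable_const _),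
    integral_const_mul]
  simp

lemma klDiv_tilted_mul_llr {Ω : Type*} [MeasurableSpace Ω] {μ ν : Measure Ω}
    [IsProbabilityMeasure μ] [IsProbabilityMeasure ν] (hμν : μ ≪ ν) {s : ℝ}
    (hs : Integrable (fun x => Real.exp (s * llr ν μ x)) μ)
    (hX : Integrable (llr ν μ) (μ.tilted fun x => s * llr ν μ x)) :
    klDiv (μ.tilted fun x => s * llr ν μ x) ν
      = (s - 1) * ∫ x, llr ν μ x ∂(μ.tilted fun x => s * llr ν μ x) - cgf (llr ν μ) μ s := by
  have hprob : IsProbabilityMeasure (μ.tilted fun x => s * llr ν μ x) :=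
    isProbabilityMeasure_tilted hs
  have h : llr (μ.tilted fun x => s * llr ν μ x) ν =ᵐ[μ.tilted fun x => s * llr ν μ x]
      fun x => (s - 1) * llr ν μ x - cgf (llr ν μ) μ s := by
    refine (tilted_absolutelyContinuous μ _).ae_le ?_
    filter_upwards [llr_tilted_left hμν hs ((measurable_llr ν μ).const_mul s).aemeasurable,
      neg_llr hμν] with x hx hx'
    rw [hx, ← hx', cgf, mgf, Pi.neg_apply]
    ring
  rw [klDiv, integral_congr_ae h, integral_sub (hX.const_mul _) (integrable_const _),
    integral_const_mul]
  simp

/-- If `P ≠ π`, then `R = dπ/dP` is not `P`-a.s. constant, `Var_{q_τ}(log R) > 0`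
for `τ ∈ (0,1)`, and hence `τ ↦ D_KL(q_τ‖P)` is strictly increasing on `(0,1]`
while `τ ↦ D_KL(q_τ‖π)` is strictly decreasing on `[0,1)`. -/
theorem escort_kl_strict_monotonicity
    {Ω : Type*} [MeasurableSpace Ω] (P pi : Measure Ω)
    [IsProbabilityMeasure P] [IsProbabilityMeasure pi]
    (hπP : pi ≪ P) (hPπ : P ≪ pi)
    (R : Ω → ℝ) (hR : R = fun x => (pi.rnDeriv P x).toReal)
    (hmom : ∀ τ ∈ Set.Icc (0 : ℝ) 1,
      Integrable (fun x => R x ^ τ * |Real.log (R x)| ^ 2) P)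
    (hne : P ≠ pi)
    (q : ℝ → Measure Ω)
    (hq : ∀ τ, q τ = P.withDensity (fun x =>
      ENNReal.ofReal (R x ^ τ / ∫ y, R y ^ τ ∂P))) :
    (¬ ∃ c : ℝ, R =ᵐ[P] fun _ => c) ∧
    (∀ τ ∈ Set.Ioo (0 : ℝ) 1,
      0 < (∫ x, Real.log (R x) ^ 2 ∂(q τ)) - (∫ x, Real.log (R x) ∂(q τ)) ^ 2) ∧
    StrictMonoOn (fun s => klDiv (q s) P) (Set.Ioc (0 : ℝ) 1) ∧
    StrictAntiOn (fun s => klDiv (q s) pi) (Set.Ico (0 : ℝ) 1) := by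
  have hRae : R =ᵐ[P] fun x => Real.exp (llr pi P x) := by
    rw [hR]
    exact (exp_llr_of_ac' pi P hPπ).symm
  have hlog : ∀ x, Real.log (R x) = llr pi P x := fun x => by rw [hR, llr]
  have hpow : ∀ τ : ℝ, (fun x => R x ^ τ) =ᵐ[P] fun x => Real.exp (τ * llr pi P x) := by
    intro τ
    filter_upwards [hRae] with x hx
    rw [hx, ← Real.exp_mul, mul_comm]
  have hqt : ∀ τ, q τ = P.tilted fun x => τ * llr pi P x := by
    intro τ
    rw [hq, Measure.tilted, integral_congr_ae (hpow τ)]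
    refine withDensity_congr_ae ?_
    filter_upwards [hpow τ] with x hx
    rw [hx]
  have hRconst : ¬ ∃ c : ℝ, R =ᵐ[P] fun _ => c := by
    rintro ⟨c, hc⟩
    have hc1 : c = 1 := by
      have h1 : ∫ x, R x ∂P = 1 := by
        rw [hR, Measure.integral_toReal_rnDeriv hπP]
        simp
      rw [integral_congr_ae hc] at h1
      simpa using h1
    refine hne ?_
    rw [← Measure.withDensity_rnDeriv_eq pi P hπP]
    have h1 : pi.rnDeriv P =ᵐ[P] 1 := by
      filter_upwards [hc] with x hx
      rw [hR, hc1] at hx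
      exact (ENNReal.toReal_eq_one_iff _).1 hx
    rw [withDensity_congr_ae h1, withDensity_one]
  have hLconst : ¬ ∃ c : ℝ, llr pi P =ᵐ[P] fun _ => c := by
    rintro ⟨c, hc⟩
    refine hRconst ⟨Real.exp c, ?_⟩
    filter_upwards [hRae, hc] with x hx hx'
    rw [hx, hx']
  have hexp : ∀ τ ∈ Set.Icc (0 : ℝ) 1, Integrable (fun x => Real.exp (τ * llr pi P x)) P := by
    have h1 : Integrable (fun x => Real.exp (1 * llr pi P x)) P := by
      refine Integrable.congr ?_ (hpow 1)
      simp only [Real.rpow_one, hR]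
      exact Measure.integrable_toReal_rnDeriv
    intro τ hτ
    exact integrable_exp_mul_of_nonneg_of_le h1 hτ.1 hτ.2
  have hmem : ∀ τ ∈ Set.Icc (0 : ℝ) 1, MemLp (llr pi P) 2 (q τ) := by
    intro τ hτ
    rw [memLp_two_iff_integrable_sq (measurable_llr pi P).aestronglyMeasurable, hqt,
      integrable_tilted_iff (hexp τ hτ)]
    refine (hmom τ hτ).congr ?_
    filter_upwards [hpow τ] with x hx
    rw [hx, hlog, sq_abs, smul_eq_mul]
  have hprob : ∀ τ ∈ Set.Icc (0 : ℝ) 1, IsProbabilityMeasure (q τ) := by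
    intro τ hτ
    rw [hqt]
    exact isProbabilityMeasure_tilted (hexp τ hτ)
  have h_int : ∀ τ ∈ Set.Icc (0 : ℝ) 1,
      Integrable (llr pi P) (P.tilted fun x => τ * llr pi P x) := by
    intro τ hτ
    have := hprob τ hτ
    rw [← hqt]
    exact (hmem τ hτ).integrable (by norm_num)
  have hkey : ∀ s ∈ Set.Icc (0 : ℝ) 1, ∀ t ∈ Set.Icc (0 : ℝ) 1, s ≠ t →
      (t - s) * ∫ x, llr pi P x ∂(P.tilted fun x => s * llr pi P x)
        < cgf (llr pi P) P t - cgf (llr pi P) P s := fun s hs t ht hst =>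
    sub_mul_integral_tilted_lt_cgf_sub hst (hexp s hs) (hexp t ht) (h_int s hs) hLconst
  have hmean : ∀ s ∈ Set.Icc (0 : ℝ) 1, ∀ t ∈ Set.Icc (0 : ℝ) 1, s < t →
      ∫ x, llr pi P x ∂(P.tilted fun x => s * llr pi P x)
        < ∫ x, llr pi P x ∂(P.tilted fun x => t * llr pi P x) := by
    intro s hs t ht hst
    have h1 := hkey s hs t ht hst.ne
    have h2 := hkey t ht s hs hst.ne'
    nlinarith
  refine ⟨hRconst, ?_, ?_, ?_⟩
  · intro τ hτ
    have hτ' := Set.Ioo_subset_Icc_self hτ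
    have := hprob τ hτ'
    have hpos : 0 < Var[llr pi P; q τ] := by
      refine variance_pos_of_not_ae_const (hmem τ hτ') ?_
      rintro ⟨c, hc⟩
      rw [hqt] at hc
      exact hLconst ⟨c, (absolutelyContinuous_tilted (hexp τ hτ')).ae_le hc⟩
    rw [variance_eq_sub (hmem τ hτ')] at hpos
    simpa only [hlog, Pi.pow_apply] using hpos
  · intro s hs t ht hst
    have hs' := Set.Ioc_subset_Icc_self hs
    have ht' := Set.Ioc_subset_Icc_self ht
    have h1 := hkey t ht' s hs' hst.ne'
    have h2 := mul_lt_mul_of_pos_left (hmean s hs' t ht' hst) hs.1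
    simp only [hqt]
    rw [klDiv_tilted_mul_self (hexp s hs') (h_int s hs'),
      klDiv_tilted_mul_self (hexp t ht') (h_int t ht')]
    linarith
  · intro s hs t ht hst
    have hs' := Set.Ico_subset_Icc_self hs
    have ht' := Set.Ico_subset_Icc_self ht
    have h1 := hkey s hs' t ht' hst.ne
    have h2 := mul_lt_mul_of_pos_left (hmean s hs' t ht' hst) (sub_pos.2 ht.2)
    simp only [hqt]
    rw [klDiv_tilted_mul_llr hPπ (hexp s hs') (h_int s hs'),
      klDiv_tilted_mul_llr hPπ (hexp t ht') (h_int t ht')]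
    linarith
end

section
/- Let P and π be probability measures on a measurable space Ω with π ≪ P and P ≪ π, let R = dπ/dP, and define the escort measure q_τ by dq_τ/dP = R^τ / ∫ R^τ dP. Suppose that for every τ ∈ [0,1], ∫ R^τ |log R|² dP < ∞, and suppose P ≠ π and D_KL(π‖P) < ∞. Then for every ε ∈ (0, D_KL(π‖P)) there exists a unique τ* ∈ (0,1) such that D_KL(q_{τ*}‖P) = ε. -/
open MeasureTheory

open Real Set ProbabilityTheory

section ExponentialTilting

variable {Ω : Type*} [MeasurableSpace Ω] {μ : Measure Ω} {X : Ω → ℝ} {s t τ : ℝ}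

lemma exp_mul_le_one_add_exp (hτ : τ ∈ Icc (0 : ℝ) 1) (y : ℝ) :
    exp (τ * y) ≤ 1 + exp y := by
  rcases le_total 0 y with hy | hy
  · have : exp (τ * y) ≤ exp y := exp_le_exp.2 (mul_le_of_le_one_left hy hτ.2)
    linarith
  · have : exp (τ * y) ≤ 1 := exp_le_one_iff.2 (mul_nonpos_of_nonneg_of_nonpos hτ.1 hy)
    linarith [exp_pos y]

lemma norm_exp_mul_le (hτ : τ ∈ Icc (0 : ℝ) 1) (y : ℝ) : ‖exp (τ * y)‖ ≤ 1 + exp y := by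
  rw [norm_of_nonneg (exp_pos _).le]
  exact exp_mul_le_one_add_exp hτ y

lemma norm_mul_exp_mul_le (hτ : τ ∈ Icc (0 : ℝ) 1) (y : ℝ) :
    ‖y * exp (τ * y)‖ ≤ |y| + |y * exp y| := by
  rw [norm_mul, norm_of_nonneg (exp_pos _).le, abs_mul, abs_of_pos (exp_pos y), norm_eq_abs]
  nlinarith [exp_mul_le_one_add_exp hτ y, abs_nonneg y]

lemma integrable_exp_mul_of_mem_Icc [IsFiniteMeasure μ] (hX : AEMeasurable X μ)
    (hexp : Integrable (fun x ↦ exp (X x)) μ) (hτ : τ ∈ Icc (0 : ℝ) 1) :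
    Integrable (fun x ↦ exp (τ * X x)) μ :=
  ((integrable_const 1).add hexp).mono' (by fun_prop) (.of_forall fun x ↦ norm_exp_mul_le hτ (X x))

lemma integrable_mul_exp_mul_of_mem_Icc (hX : Integrable X μ)
    (hXexp : Integrable (fun x ↦ X x * exp (X x)) μ) (hτ : τ ∈ Icc (0 : ℝ) 1) :
    Integrable (fun x ↦ X x * exp (τ * X x)) μ := by
  have := hX.aemeasurable
  exact (hX.abs.add hXexp.abs).mono' (by fun_prop)
    (.of_forall fun x ↦ norm_mul_exp_mul_le hτ (X x))

lemma continuousOn_mgf_Icc [IsFiniteMeasure μ] (hX : AEMeasurable X μ)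
    (hexp : Integrable (fun x ↦ exp (X x)) μ) : ContinuousOn (mgf X μ) (Icc 0 1) :=
  continuousOn_of_dominated (fun τ _ ↦ by fun_prop)
    (fun τ hτ ↦ .of_forall fun x ↦ norm_exp_mul_le hτ (X x))
    ((integrable_const 1).add hexp) (.of_forall fun x ↦ by fun_prop)

lemma continuousOn_integral_mul_exp_mul_Icc (hX : Integrable X μ)
    (hXexp : Integrable (fun x ↦ X x * exp (X x)) μ) :
    ContinuousOn (fun τ : ℝ ↦ ∫ x, X x * exp (τ * X x) ∂μ) (Icc 0 1) := by
  have := hX.aemeasurable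
  exact continuousOn_of_dominated (fun τ _ ↦ by fun_prop)
    (fun τ hτ ↦ .of_forall fun x ↦ norm_mul_exp_mul_le hτ (X x))
    (hX.abs.add hXexp.abs) (.of_forall fun x ↦ by fun_prop)

/-- The mean of `X` under the exponentially tilted measure, `∫ X exp (τ X) dμ / ∫ exp (τ X) dμ`. -/
noncomputable def tiltedMean (X : Ω → ℝ) (μ : Measure Ω) (τ : ℝ) : ℝ :=
  (∫ x, X x * exp (τ * X x) ∂μ) / mgf X μ τ

/-- Strict convexity of the cumulant generating function: it lies above its tangents. -/
lemma sub_mul_tiltedMean_lt_cgf_sub [IsProbabilityMeasure μ]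
    (hs : Integrable (fun x ↦ exp (s * X x)) μ) (ht : Integrable (fun x ↦ exp (t * X x)) μ)
    (hXs : Integrable (fun x ↦ X x * exp (s * X x)) μ)
    (hne : ∀ c, ¬ X =ᵐ[μ] fun _ ↦ c) (hst : s ≠ t) :
    (t - s) * tiltedMean X μ s < cgf X μ t - cgf X μ s := by
  set a := tiltedMean X μ s with ha
  have hZs := mgf_pos hs
  have hZt := mgf_pos ht
  have hM : ∫ x, X x * exp (s * X x) ∂μ = a * mgf X μ s := by
    rw [ha, tiltedMean, div_mul_cancel₀ _ hZs.ne']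
  let f := fun x ↦ exp (-((t - s) * a)) * exp (t * X x)
    - ((1 - (t - s) * a) * exp (s * X x) + (t - s) * (X x * exp (s * X x)))
  have hlin : Integrable (fun x ↦ (1 - (t - s) * a) * exp (s * X x)
      + (t - s) * (X x * exp (s * X x))) μ :=
    (hs.const_mul _).add (hXs.const_mul _)
  have hf : Integrable f μ :=
    (ht.const_mul _).sub hlin
  have hf_eq x : f x = exp (s * X x) *
      (exp ((t - s) * (X x - a)) - ((t - s) * (X x - a) + 1)) := by
    have : exp (-((t - s) * a)) * exp (t * X x) =
        exp (s * X x) * exp ((t - s) * (X x - a)) := by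
      rw [← exp_add, ← exp_add]; ring_nf
    simp only [f, this]; ring
  have hf_nonneg x : 0 ≤ f x := by
    rw [hf_eq]
    exact mul_nonneg (exp_pos _).le (sub_nonneg.2 (add_one_le_exp _))
  have hf_int : ∫ x, f x ∂μ = exp (-((t - s) * a)) * mgf X μ t - mgf X μ s := by
    simp only [f]
    rw [integral_sub (ht.const_mul _) hlin,
      integral_add (hs.const_mul _) (hXs.const_mul _), integral_const_mul, integral_const_mul,
      integral_const_mul, hM]
    simp only [mgf]; ring
  have hf_pos : 0 < ∫ x, f x ∂μ := by
    refine (integral_nonneg hf_nonneg).lt_of_ne' fun h0 ↦ hne a ?_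
    rw [integral_eq_zero_iff_of_nonneg hf_nonneg hf] at h0
    filter_upwards [h0] with x hx
    by_contra hxa
    have hu : (t - s) * (X x - a) ≠ 0 :=
      mul_ne_zero (sub_ne_zero.2 hst.symm) (sub_ne_zero.2 hxa)
    have := mul_pos (exp_pos (s * X x)) (sub_pos.2 (add_one_lt_exp hu))
    rw [← hf_eq, hx] at this
    exact this.false
  rw [hf_int, sub_pos] at hf_pos
  have := log_lt_log hZs hf_pos
  rw [log_mul (exp_pos _).ne' hZt.ne', log_exp] at this
  simp only [cgf]
  linarith

lemma strictMonoOn_mul_tiltedMean_sub_cgf [IsProbabilityMeasure μ] (hX : Integrable X μ)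
    (hexp : Integrable (fun x ↦ exp (X x)) μ) (hXexp : Integrable (fun x ↦ X x * exp (X x)) μ)
    (hne : ∀ c, ¬ X =ᵐ[μ] fun _ ↦ c) :
    StrictMonoOn (fun τ ↦ τ * tiltedMean X μ τ - cgf X μ τ) (Icc 0 1) := by
  intro s hs t ht hst
  have tangent {u v : ℝ} (hu : u ∈ Icc (0 : ℝ) 1) (hv : v ∈ Icc (0 : ℝ) 1) (huv : u ≠ v) :=
    sub_mul_tiltedMean_lt_cgf_sub (integrable_exp_mul_of_mem_Icc hX.aemeasurable hexp hu)
      (integrable_exp_mul_of_mem_Icc hX.aemeasurable hexp hv)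
      (integrable_mul_exp_mul_of_mem_Icc hX hXexp hu) hne huv
  have h1 := tangent hs ht hst.ne
  have h2 := tangent ht hs hst.ne'
  have hmean : tiltedMean X μ s ≤ tiltedMean X μ t := by
    by_contra! h
    nlinarith [mul_pos (sub_pos.2 hst) (sub_pos.2 h)]
  have := mul_le_mul_of_nonneg_left hmean hs.1
  simp only
  linarith

lemma continuousOn_mul_tiltedMean_sub_cgf [IsProbabilityMeasure μ] (hX : Integrable X μ)
    (hexp : Integrable (fun x ↦ exp (X x)) μ) (hXexp : Integrable (fun x ↦ X x * exp (X x)) μ) :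
    ContinuousOn (fun τ ↦ τ * tiltedMean X μ τ - cgf X μ τ) (Icc 0 1) := by
  have hZ := continuousOn_mgf_Icc hX.aemeasurable hexp
  have hZ0 τ (hτ : τ ∈ Icc (0 : ℝ) 1) : mgf X μ τ ≠ 0 :=
    (mgf_pos (integrable_exp_mul_of_mem_Icc hX.aemeasurable hexp hτ)).ne'
  exact (continuousOn_id.mul ((continuousOn_integral_mul_exp_mul_Icc hX hXexp).div hZ hZ0)).sub
    (hZ.log hZ0)

lemma klDiv_tilted_mul [IsProbabilityMeasure μ]
    (hexp : Integrable (fun x ↦ exp (τ * X x)) μ)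
    (hXexp : Integrable (fun x ↦ X x * exp (τ * X x)) μ) :
    klDiv (μ.tilted (τ * X ·)) μ = τ * tiltedMean X μ τ - cgf X μ τ := by
  have hZ := mgf_pos hexp
  calc klDiv (μ.tilted (τ * X ·)) μ
      = ∫ x, (τ * X x - cgf X μ τ) ∂(μ.tilted (τ * X ·)) :=
        integral_congr_ae
          ((tilted_absolutelyContinuous μ _).ae_le (log_rnDeriv_tilted_left_self hexp))
    _ = ∫ x, (τ / mgf X μ τ * (X x * exp (τ * X x))
          - cgf X μ τ / mgf X μ τ * exp (τ * X x)) ∂μ := by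
        rw [integral_tilted_mul_eq_mgf]
        congr with x
        rw [smul_eq_mul]; ring
    _ = τ * tiltedMean X μ τ - cgf X μ τ := by
        rw [integral_sub (hXexp.const_mul _) (hexp.const_mul _), integral_const_mul,
          integral_const_mul, tiltedMean]
        change _ - cgf X μ τ / mgf X μ τ * mgf X μ τ = _
        rw [div_mul_cancel₀ _ hZ.ne']; ring

lemma existsUnique_klDiv_tilted_eq [IsProbabilityMeasure μ] (hX : Integrable X μ)
    (hexp : Integrable (fun x ↦ exp (X x)) μ) (hXexp : Integrable (fun x ↦ X x * exp (X x)) μ)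
    (hne : ∀ c, ¬ X =ᵐ[μ] fun _ ↦ c) {ε : ℝ} (hε : ε ∈ Ioo 0 (klDiv (μ.tilted X) μ)) :
    ∃! τ : ℝ, τ ∈ Ioo (0 : ℝ) 1 ∧ klDiv (μ.tilted (τ * X ·)) μ = ε := by
  have hkl {τ : ℝ} (hτ : τ ∈ Icc (0 : ℝ) 1) :=
    klDiv_tilted_mul (integrable_exp_mul_of_mem_Icc hX.aemeasurable hexp hτ)
      (integrable_mul_exp_mul_of_mem_Icc hX hXexp hτ)
  have h1 : klDiv (μ.tilted X) μ = 1 * tiltedMean X μ 1 - cgf X μ 1 := by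
    simpa using hkl (right_mem_Icc.2 zero_le_one)
  obtain ⟨τ, hτ, hτε⟩ := intermediate_value_Ioo zero_le_one
    (continuousOn_mul_tiltedMean_sub_cgf hX hexp hXexp) (a := (0 : ℝ)) (b := 1) (by
      simpa [h1] using hε)
  refine ⟨τ, ⟨hτ, (hkl (Ioo_subset_Icc_self hτ)).trans hτε⟩, fun σ ⟨hσ, hσε⟩ ↦ ?_⟩
  rw [hkl (Ioo_subset_Icc_self hσ)] at hσε
  exact (strictMonoOn_mul_tiltedMean_sub_cgf hX hexp hXexp hne).injOn
    (Ioo_subset_Icc_self hσ) (Ioo_subset_Icc_self hτ) (hσε.trans hτε.symm)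

end ExponentialTilting

section LogLikelihoodRatio

variable {Ω : Type*} [MeasurableSpace Ω] {μ ν : Measure Ω}

lemma tilted_llr [IsProbabilityMeasure μ] [IsProbabilityMeasure ν] (hνμ : ν ≪ μ) (hμν : μ ≪ ν) :
    μ.tilted (llr ν μ) = ν := by
  have h := exp_llr_of_ac' ν μ hμν
  have hint : ∫ x, exp (llr ν μ x) ∂μ = 1 := by
    rw [integral_congr_ae h, Measure.integral_toReal_rnDeriv hνμ, probReal_univ]
  rw [Measure.tilted, hint]
  conv_rhs => rw [← Measure.withDensity_rnDeriv_eq ν μ hνμ]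
  refine withDensity_congr_ae ?_
  filter_upwards [h, ν.rnDeriv_lt_top μ] with x hx hx'
  rw [hx, div_one, ENNReal.ofReal_toReal hx'.ne]

lemma not_llr_ae_eq_const [IsProbabilityMeasure μ] [IsProbabilityMeasure ν]
    (hνμ : ν ≪ μ) (hμν : μ ≪ ν) (hne : μ ≠ ν) (c : ℝ) : ¬ llr ν μ =ᵐ[μ] fun _ ↦ c := by
  intro h
  apply hne
  rw [← tilted_llr hνμ hμν, tilted_congr h, tilted_const]

lemma integrable_exp_llr [SigmaFinite μ] [IsFiniteMeasure ν] (hμν : μ ≪ ν) :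
    Integrable (fun x ↦ exp (llr ν μ x)) μ :=
  Measure.integrable_toReal_rnDeriv.congr (exp_llr_of_ac' ν μ hμν).symm

lemma integrable_llr_mul_exp_llr [SigmaFinite μ] [SigmaFinite ν] (hνμ : ν ≪ μ) (hμν : μ ≪ ν)
    (h : Integrable (llr ν μ) ν) : Integrable (fun x ↦ llr ν μ x * exp (llr ν μ x)) μ := by
  refine ((integrable_rnDeriv_mul_log_iff hνμ).2 h).congr ?_
  filter_upwards [exp_llr_of_ac' ν μ hμν] with x hx
  rw [hx, mul_comm, llr]

end LogLikelihoodRatio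

/-- For every trust-region radius `ε ∈ (0, D_KL(π‖P))` there is a unique
`τ* ∈ (0,1)` with `D_KL(q_{τ*}‖P) = ε`. -/
theorem escort_trust_region_radius_exists_unique
    {Ω : Type*} [MeasurableSpace Ω] (P pi : Measure Ω)
    [IsProbabilityMeasure P] [IsProbabilityMeasure pi]
    (hπP : pi ≪ P) (hPπ : P ≪ pi)
    (R : Ω → ℝ) (hR : R = fun x => (pi.rnDeriv P x).toReal)
    (hmom : ∀ τ ∈ Set.Icc (0 : ℝ) 1,
      Integrable (fun x => R x ^ τ * |Real.log (R x)| ^ 2) P)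
    (hne : P ≠ pi)
    (hfin : Integrable (llr pi P) pi)
    (q : ℝ → Measure Ω)
    (hq : ∀ τ, q τ = P.withDensity (fun x =>
      ENNReal.ofReal (R x ^ τ / ∫ y, R y ^ τ ∂P))) :
    ∀ ε ∈ Set.Ioo (0 : ℝ) (klDiv pi P),
      ∃! τ : ℝ, τ ∈ Set.Ioo (0 : ℝ) 1 ∧ klDiv (q τ) P = ε := by
  subst hR
  have hlog := exp_llr_of_ac' pi P hPπ
  have hpow (τ : ℝ) : (fun x ↦ (pi.rnDeriv P x).toReal ^ τ) =ᵐ[P]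
      fun x ↦ exp (τ * llr pi P x) := by
    filter_upwards [hlog] with x hx
    rw [← hx, ← exp_mul, mul_comm]
  have hq_tilted (τ : ℝ) : q τ = P.tilted (τ * llr pi P ·) := by
    rw [hq, Measure.tilted, integral_congr_ae (hpow τ)]
    refine withDensity_congr_ae ?_
    filter_upwards [hpow τ] with x hx
    rw [hx]
  have hX : Integrable (llr pi P) P := by
    refine MemLp.integrable (q := 2) (by norm_num) ?_
    rw [memLp_two_iff_integrable_sq (measurable_llr pi P).aestronglyMeasurable]
    simpa [llr] using hmom 0 (left_mem_Icc.2 zero_le_one)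
  intro ε hε
  simp only [hq_tilted]
  exact existsUnique_klDiv_tilted_eq hX (integrable_exp_llr hPπ)
    (integrable_llr_mul_exp_llr hπP hPπ hfin) (not_llr_ae_eq_const hπP hPπ hne)
    (by rwa [tilted_llr hπP hPπ])
end

section
/- Let π, q, and Q be probability measures on a measurable space Ω with q ≪ π, π ≪ q, Q ≪ q, and q ≪ Q. Let ℓ = log(dq/dπ) and suppose ℓ is essentially bounded with ‖ℓ‖_∞ ≤ M for some M ≥ 0, and suppose the relevant KL divergences are finite. Then D_KL(Q‖π) ≤ D_KL(Q‖q) + D_KL(q‖π) + M · √(2 · D_KL(q‖Q)). -/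
open MeasureTheory

section

variable {Ω : Type*} [MeasurableSpace Ω] {μ ν κ : Measure Ω}

lemma klDiv_nonneg [IsProbabilityMeasure μ] [IsProbabilityMeasure ν]
    (hμν : μ ≪ ν) (h_int : Integrable (llr μ ν) μ) : 0 ≤ klDiv μ ν := by
  simpa [klDiv] using InformationTheory.integral_llr_add_sub_measure_univ_nonneg hμν h_int

/-- The chain rule for log-likelihood ratios. -/
lemma llr_add_llr_ae_eq [SigmaFinite μ] [SigmaFinite ν] [SigmaFinite κ]
    (hμν : μ ≪ ν) (hνκ : ν ≪ κ) : llr μ ν + llr ν κ =ᵐ[μ] llr μ κ := by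
  have toReal_rnDeriv_pos {ρ τ : Measure Ω} [SigmaFinite ρ] [SigmaFinite τ] (h : ρ ≪ τ) :
      ∀ᵐ x ∂ρ, 0 < (ρ.rnDeriv τ x).toReal := by
    filter_upwards [Measure.rnDeriv_pos h, h.ae_le (Measure.rnDeriv_lt_top ρ τ)]
      with x h_pos h_top using ENNReal.toReal_pos h_pos.ne' h_top.ne
  filter_upwards [(hμν.trans hνκ).ae_le (Measure.rnDeriv_mul_rnDeriv (κ := κ) hμν),
    toReal_rnDeriv_pos hμν, hμν.ae_le (toReal_rnDeriv_pos hνκ)] with x hx h₁ h₂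
  simp only [Pi.add_apply, llr, ← hx, Pi.mul_apply, ENNReal.toReal_mul]
  exact (Real.log_mul h₁.ne' h₂.ne').symm

/-- The **Donsker–Varadhan** inequality. -/
lemma integral_le_klDiv_add_log_integral_exp [IsProbabilityMeasure μ] [IsProbabilityMeasure ν]
    (hμν : μ ≪ ν) (h_int : Integrable (llr μ ν) μ) {f : Ω → ℝ} (hfμ : Integrable f μ)
    (hfν : Integrable (fun x ↦ Real.exp (f x)) ν) :
    ∫ x, f x ∂μ ≤ klDiv μ ν + Real.log (∫ x, Real.exp (f x) ∂ν) := by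
  have := isProbabilityMeasure_tilted hfν
  have h := klDiv_nonneg (hμν.trans (absolutelyContinuous_tilted hfν))
    (integrable_llr_tilted_right hμν hfμ h_int hfν)
  rw [klDiv, integral_llr_tilted_right hμν hfμ hfν h_int] at h
  rw [klDiv]
  linarith

/-- A form of **Pinsker's inequality**: the integrals of a function bounded by `M` against two
probability measures differ by at most `M √(2 D_KL(μ‖ν))`. -/
lemma abs_integral_sub_integral_le [IsProbabilityMeasure μ] [IsProbabilityMeasure ν]
    (hμν : μ ≪ ν) (h_int : Integrable (llr μ ν) μ) {f : Ω → ℝ} {M : ℝ} (hM : 0 ≤ M)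
    (hf : AEMeasurable f ν) (hfM : ∀ᵐ x ∂ν, |f x| ≤ M) :
    |∫ x, f x ∂μ - ∫ x, f x ∂ν| ≤ M * √(2 * klDiv μ ν) := by
  have hfν : ∀ᵐ x ∂ν, f x ∈ Set.Icc (-M) M := by
    filter_upwards [hfM] with x hx using abs_le.1 hx
  have hfμ : Integrable f μ := Integrable.of_mem_Icc (-M) M (hf.mono_ac hμν) (hμν.ae_le hfν)
  have hsub := ProbabilityTheory.hasSubgaussianMGF_of_mem_Icc hf hfν
  have hquad (t : ℝ) : 0 ≤ M ^ 2 / 2 * (t * t) + -(∫ x, f x ∂μ - ∫ x, f x ∂ν) * t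
      + klDiv μ ν := by
    have hdv := integral_le_klDiv_add_log_integral_exp hμν h_int
      ((hfμ.sub (integrable_const (∫ x, f x ∂ν))).const_mul t) (hsub.integrable_exp_mul t)
    have hcgf := hsub.cgf_le t
    have hnorm : ‖M - -M‖ = 2 * M := by
      rw [Real.norm_of_nonneg (by linarith)]; ring
    simp only [ProbabilityTheory.cgf, ProbabilityTheory.mgf, NNReal.coe_pow, NNReal.coe_div,
      coe_nnnorm, hnorm, NNReal.coe_ofNat] at hcgf
    simp only [Pi.sub_apply, integral_const_mul, integral_sub hfμ (integrable_const _),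
      integral_const, probReal_univ, one_smul] at hdv
    linarith
  have hdisc := discrim_le_zero hquad
  rw [discrim] at hdisc
  calc |∫ x, f x ∂μ - ∫ x, f x ∂ν| ≤ √(M ^ 2 * (2 * klDiv μ ν)) :=
        Real.abs_le_sqrt (by linarith)
    _ = M * √(2 * klDiv μ ν) := by rw [Real.sqrt_mul (sq_nonneg M), Real.sqrt_sq hM]

end

/-- Projection error bound: if `ℓ = log (dq/dπ)` is essentially bounded by `M`,
then `D_KL(Q‖π) ≤ D_KL(Q‖q) + D_KL(q‖π) + M √(2 D_KL(q‖Q))`. -/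
theorem projection_error_bound
    {Ω : Type*} [MeasurableSpace Ω] (pi q Q : Measure Ω)
    [IsProbabilityMeasure pi] [IsProbabilityMeasure q] [IsProbabilityMeasure Q]
    (hqπ : q ≪ pi) (hπq : pi ≪ q) (hQq : Q ≪ q) (hqQ : q ≪ Q)
    (M : ℝ) (hM : 0 ≤ M)
    (hbound : ∀ᵐ x ∂q, |llr q pi x| ≤ M)
    (hQπ_int : Integrable (llr Q pi) Q)
    (hQq_int : Integrable (llr Q q) Q)
    (hqπ_int : Integrable (llr q pi) q)
    (hqQ_int : Integrable (llr q Q) q) :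
    klDiv Q pi ≤ klDiv Q q + klDiv q pi + M * Real.sqrt (2 * klDiv q Q) := by
  have hchain : klDiv Q pi = klDiv Q q + ∫ x, llr q pi x ∂Q := by
    have hint : Integrable (llr q pi) Q :=
      Integrable.of_mem_Icc (-M) M (measurable_llr q pi).aemeasurable
        (hQq.ae_le (hbound.mono fun x hx ↦ abs_le.1 hx))
    rw [klDiv, klDiv, ← integral_add hQq_int hint]
    exact integral_congr_ae (llr_add_llr_ae_eq hQq hqπ).symm
  have hpinsker := abs_integral_sub_integral_le hqQ hqQ_int hM
    (measurable_llr q pi).aemeasurable (hQq.ae_le hbound)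
  have hkl : klDiv q pi = ∫ x, llr q pi x ∂q := rfl
  linarith [neg_le_of_abs_le hpinsker]
end
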